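/- arXiv:2305.00683 — 2 statements merged into one kernel-verified Lean document; each statement's English description precedes it below -/
import Mathlib

section
/- Assume Φ is irreducible. If J and J' are subsets of the base Δ such that Φ = Φ_J ∪ Φ_{J'}, then J = Δ or J' = Δ. -/
/-- A finite crystallographic root system `Φ` in a finite-dimensional `ℚ`-vector space `V`,
together with a chosen base `Δ` of simple roots.  For each root `α` the linear functional
`coroot α` is its coroot, pairing with vectors via evaluation. -/
structure BasedRootSystem (V : Type*) [AddCommGroup V] [Module ℚ V] where
  /-- The (finite) set of roots. -/
  Φ : Finset V
  /-- The coroot attached to each root, as a linear functional on `V`. -/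
  coroot : V → Module.Dual ℚ V
  /-- The chosen base (set of simple roots). -/
  Δ : Finset V
  zero_not_mem : (0 : V) ∉ Φ
  span_eq_top : Submodule.span ℚ (Φ : Set V) = ⊤
  coroot_self_eq_two : ∀ α ∈ Φ, coroot α α = 2
  reflect_mem : ∀ α ∈ Φ, ∀ β ∈ Φ, β - coroot α β • α ∈ Φ
  crystallographic : ∀ α ∈ Φ, ∀ β ∈ Φ, ∃ n : ℤ, coroot α β = (n : ℚ)
  base_subset : Δ ⊆ Φ
  base_indep : LinearIndependent ℚ (Subtype.val : {x // x ∈ Δ} → V)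
  base_decomp : ∀ β ∈ Φ,
    (∃ c : V → ℚ, (∀ α ∈ Δ, 0 ≤ c α) ∧ β = ∑ α ∈ Δ, c α • α) ∨
    (∃ c : V → ℚ, (∀ α ∈ Δ, c α ≤ 0) ∧ β = ∑ α ∈ Δ, c α • α)

namespace BasedRootSystem

variable {V : Type*} [AddCommGroup V] [Module ℚ V] (P : BasedRootSystem V)

open Classical in
/-- The set `Φ⁺` of positive roots: the roots which are nonnegative linear
combinations of the simple roots. -/
noncomputable def pos : Finset V :=
  P.Φ.filter fun β => ∃ c : V → ℚ, (∀ α ∈ P.Δ, 0 ≤ c α) ∧ β = ∑ α ∈ P.Δ, c α • α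

open Classical in
/-- For `J ⊆ Δ`, the sub-root system `Φ_J = Φ ∩ span J`. -/
noncomputable def rootsIn (J : Finset V) : Finset V :=
  P.Φ.filter fun β => β ∈ Submodule.span ℚ (J : Set V)

/-- The subgroup `W_J` of the Weyl group generated by the reflections in the roots
belonging to `J`. -/
def weylGroupOf (J : Finset V) : Subgroup (V ≃ₗ[ℚ] V) :=
  Subgroup.closure
    { g | ∃ α, ∃ h : α ∈ P.Φ, α ∈ J ∧ g = Module.reflection (P.coroot_self_eq_two α h) }

/-- Irreducibility of the root system: the roots cannot be split into two nonempty
mutually orthogonal parts. -/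
def IsIrreducible : Prop :=
  P.Φ.Nonempty ∧ ∀ s : Set V,
    (∀ α ∈ P.Φ, ∀ β ∈ P.Φ, α ∈ s → β ∉ s → P.coroot α β = 0) →
    (∀ α ∈ P.Φ, α ∈ s) ∨ (∀ α ∈ P.Φ, α ∉ s)

end BasedRootSystem

namespace BasedRootSystem

/-- If every root of an irreducible root system lies in one of two subspaces, then all roots lie in
one of them. -/
theorem IsIrreducible.forall_mem_or_forall_mem {V : Type*} [AddCommGroup V] [Module ℚ V]
    {P : BasedRootSystem V} (hirr : P.IsIrreducible) (U U' : Submodule ℚ V)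
    (h : ∀ β ∈ P.Φ, β ∈ U ∨ β ∈ U') :
    (∀ β ∈ P.Φ, β ∈ U) ∨ (∀ β ∈ P.Φ, β ∈ U') := by
  let T : Submodule ℚ V := Submodule.span ℚ {β | β ∈ P.Φ ∧ β ∉ U}
  have hT : T ≤ U' := Submodule.span_le.2 fun β hβ => (h β hβ.1).resolve_left hβ.2
  have hA : ∀ β ∈ P.Φ, β ∉ U → β ∈ T := fun β hβ hU => Submodule.subset_span ⟨hβ, hU⟩
  have hstable : ∀ α ∈ P.Φ, ∀ v ∈ T, P.coroot α v • α ∈ T := by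
    intro α hα v hv
    induction hv using Submodule.span_induction with
    | mem v hv =>
      by_cases hαU : α ∈ U
      · have hr : v - P.coroot α v • α ∈ T := by
          refine hA _ (P.reflect_mem α hα v hv.1) fun hmem => hv.2 ?_
          simpa using U.add_mem hmem (U.smul_mem (P.coroot α v) hαU)
        simpa using T.sub_mem (hA v hv.1 hv.2) hr
      · exact T.smul_mem _ (hA α hα hαU)
    | zero => simp
    | add x y _ _ hx hy => simpa [add_smul] using T.add_mem hx hy
    | smul a x _ hx => simpa [mul_smul] using T.smul_mem a hx
  rcases hirr.2 {v | v ∉ T} fun α hα β _ hαT hβT => by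
    by_contra hne
    exact hαT ((T.smul_mem_iff hne).1 (hstable α hα β (not_not.1 hβT))) with hall | hall
  · exact Or.inl fun β hβ => by_contra fun hU => hall β hβ (hA β hβ hU)
  · exact Or.inr fun β hβ => hT (not_not.1 (hall β hβ))

/-- A set of simple roots whose span contains every root is the whole base. -/
theorem eq_base_of_forall_mem_span {V : Type*} [AddCommGroup V] [Module ℚ V]
    (P : BasedRootSystem V) {J : Finset V} (hJ : J ⊆ P.Δ)
    (h : ∀ β ∈ P.Φ, β ∈ Submodule.span ℚ (J : Set V)) : J = P.Δ := by
  refine hJ.antisymm fun α hα => by_contra fun hαJ => ?_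
  refine P.base_indep.notMem_span_image (s := {x | x.1 ∈ J}) (x := ⟨α, hα⟩) hαJ ?_
  refine Submodule.span_mono ?_ (h α (P.base_subset hα))
  exact fun x hx => ⟨⟨x, hJ hx⟩, hx, rfl⟩

end BasedRootSystem

/-- if `Φ` is irreducible and `Φ = Φ_J ∪ Φ_J'`, then `J = Δ` or `J' = Δ`. -/
theorem eq_base_or_eq_base_of_union_rootsIn_eq
    {V : Type*} [AddCommGroup V] [Module ℚ V] [FiniteDimensional ℚ V]
    (P : BasedRootSystem V) [DecidableEq V]
    (hirr : P.IsIrreducible)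
    (J J' : Finset V) (hJ : J ⊆ P.Δ) (hJ' : J' ⊆ P.Δ)
    (hcover : P.Φ = P.rootsIn J ∪ P.rootsIn J') :
    J = P.Δ ∨ J' = P.Δ := by
  refine (hirr.forall_mem_or_forall_mem (Submodule.span ℚ (J : Set V))
    (Submodule.span ℚ (J' : Set V)) fun β hβ => ?_).imp
    (P.eq_base_of_forall_mem_span hJ) (P.eq_base_of_forall_mem_span hJ')
  classical
  rw [hcover, Finset.mem_union] at hβ
  exact hβ.imp (fun h => (Finset.mem_filter.1 h).2) fun h => (Finset.mem_filter.1 h).2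
end

section
/- Assume Φ is irreducible and let J ⊊ Δ be a proper subset of the base. Let v be a dominant element of the dual space such that v lies in the ℚ-linear span of the coroots {β^∨ : β ∈ Φ_J}. Then v is central, i.e. ⟨v, α⟩ = 0 for every root α ∈ Φ. -/
namespace BasedRootSystem

variable {V : Type*} [AddCommGroup V] [Module ℚ V] (P : BasedRootSystem V)

lemma neg_mem {β : V} (hβ : β ∈ P.Φ) : -β ∈ P.Φ := by
  have h := P.reflect_mem β hβ β hβ
  rw [P.coroot_self_eq_two β hβ, two_smul] at h
  simpa using h

/-- Reindexing a sum over the roots by the reflection in a root. -/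
lemma sum_reflect {β : V} (hβ : β ∈ P.Φ) (F : V → ℚ) :
    ∑ α ∈ P.Φ, F (α - P.coroot β α • β) = ∑ α ∈ P.Φ, F α := by
  have key (α : V) : α - P.coroot β α • β - P.coroot β (α - P.coroot β α • β) • β = α := by
    rw [map_sub, map_smul, P.coroot_self_eq_two β hβ, smul_eq_mul]
    module
  exact Finset.sum_bij' (fun α _ => α - P.coroot β α • β) (fun α _ => α - P.coroot β α • β)
    (fun α hα => P.reflect_mem β hβ α hα) (fun α hα => P.reflect_mem β hβ α hα)
    (fun α _ => key α) (fun α _ => key α) (fun _ _ => rfl)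

lemma two_mul_sum_mul_coroot {β : V} (hβ : β ∈ P.Φ) (f : Module.Dual ℚ V) :
    2 * ∑ α ∈ P.Φ, f α * P.coroot β α =
      f β * ∑ α ∈ P.Φ, P.coroot β α * P.coroot β α := by
  have h := P.sum_reflect hβ (fun α => f α * P.coroot β α)
  have h' : ∑ α ∈ P.Φ, f (α - P.coroot β α • β) * P.coroot β (α - P.coroot β α • β) =
      f β * ∑ α ∈ P.Φ, P.coroot β α * P.coroot β α - ∑ α ∈ P.Φ, f α * P.coroot β α := by
    rw [Finset.mul_sum, ← Finset.sum_sub_distrib]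
    refine Finset.sum_congr rfl fun α _ => ?_
    simp only [map_sub, map_smul, P.coroot_self_eq_two β hβ, smul_eq_mul]
    ring
  linarith

/-- The map `f ↦ ∑ α ∈ Φ, f α • α` attached to the canonical bilinear form on the dual space. -/
def dualForm : Module.Dual ℚ V →ₗ[ℚ] V where
  toFun f := ∑ α ∈ P.Φ, f α • α
  map_add' f g := by simp [add_smul, Finset.sum_add_distrib]
  map_smul' c f := by simp [mul_smul, Finset.smul_sum]

lemma apply_dualForm (f g : Module.Dual ℚ V) :
    g (P.dualForm f) = ∑ α ∈ P.Φ, f α * g α := by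
  simp [dualForm]

lemma eq_zero_of_apply_dualForm_self_nonpos {f : Module.Dual ℚ V}
    (hf : f (P.dualForm f) ≤ 0) : f = 0 := by
  rw [apply_dualForm] at hf
  have h0 := (Finset.sum_eq_zero_iff_of_nonneg fun α _ => mul_self_nonneg (f α)).1
    (le_antisymm hf (Finset.sum_nonneg fun α _ => mul_self_nonneg (f α)))
  refine LinearMap.ext_on P.span_eq_top fun α hα => ?_
  simpa using h0 α hα

/-- There is a positive definite symmetric form with respect to which coroots are positive
multiples of roots. -/
lemma exists_form [FiniteDimensional ℚ V] :
    ∃ C : V →ₗ[ℚ] Module.Dual ℚ V, (∀ x y, C x y = C y x) ∧ (∀ x, C x x ≤ 0 → x = 0) ∧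
      ∀ β ∈ P.Φ, ∃ n : ℚ, 0 < n ∧ P.coroot β = n • C β := by
  have hinj : Function.Injective P.dualForm := by
    rw [injective_iff_map_eq_zero]
    intro f hf
    apply P.eq_zero_of_apply_dualForm_self_nonpos
    simp [hf]
  let e := LinearEquiv.ofInjectiveOfFinrankEq P.dualForm hinj Subspace.dual_finrank_eq
  have he (f : Module.Dual ℚ V) : e f = P.dualForm f := rfl
  have hC (x y : V) : e.symm x y = ∑ α ∈ P.Φ, e.symm x α * e.symm y α := by
    conv_lhs => rw [← e.apply_symm_apply y, he, apply_dualForm]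
    exact Finset.sum_congr rfl fun _ _ => mul_comm _ _
  refine ⟨e.symm.toLinearMap, fun x y => ?_, fun x hx => ?_, fun β hβ => ?_⟩
  · simp only [LinearEquiv.coe_coe]
    rw [hC, hC]
    exact Finset.sum_congr rfl fun _ _ => mul_comm _ _
  · have : e.symm x = 0 := P.eq_zero_of_apply_dualForm_self_nonpos <| by
      rw [← he, e.apply_symm_apply]
      exact hx
    simpa using this
  · set N := ∑ α ∈ P.Φ, P.coroot β α * P.coroot β α
    have hN : 0 < N := Finset.sum_pos' (fun α _ => mul_self_nonneg _)
      ⟨β, hβ, by rw [P.coroot_self_eq_two β hβ]; norm_num⟩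
    refine ⟨N / 2, by positivity, ?_⟩
    have h : e (P.coroot β) = (N / 2) • β := by
      rw [← sub_eq_zero]
      refine (Module.forall_dual_apply_eq_zero_iff ℚ _).1 fun f => ?_
      have h2 := P.two_mul_sum_mul_coroot hβ f
      rw [map_sub, map_smul, he, apply_dualForm, smul_eq_mul]
      simp only [mul_comm (P.coroot β _) (f _)]
      linarith
    rw [LinearEquiv.coe_coe, ← map_smul, ← h, e.symm_apply_apply]

/-- The simple roots form a basis of the ambient space. -/
lemma exists_basis : ∃ b : Module.Basis {x // x ∈ P.Δ} ℚ V, ∀ i, b i = i := by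
  refine ⟨Module.Basis.mk P.base_indep ?_, fun i => Module.Basis.mk_apply ..⟩
  rw [← P.span_eq_top, Submodule.span_le]
  intro β hβ
  obtain ⟨c, -, rfl⟩ | ⟨c, -, rfl⟩ := P.base_decomp β hβ <;>
  exact Submodule.sum_mem _ fun α hα =>
    Submodule.smul_mem _ _ (Submodule.subset_span ⟨⟨α, hα⟩, rfl⟩)

variable {P}

lemma repr_nonneg_or_nonpos {b : Module.Basis {x // x ∈ P.Δ} ℚ V} (hb : ∀ i, b i = i)
    {β : V} (hβ : β ∈ P.Φ) : (∀ i, 0 ≤ b.repr β i) ∨ (∀ i, b.repr β i ≤ 0) := by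
  have key (c : V → ℚ) (i) : b.repr (∑ α ∈ P.Δ, c α • α) i = c i := by
    rw [← Finset.sum_coe_sort]
    simp only [← hb]
    rw [b.repr_sum_self]
  obtain ⟨c, hc, rfl⟩ | ⟨c, hc, rfl⟩ := P.base_decomp β hβ
  · exact Or.inl fun i => by rw [key]; exact hc i i.2
  · exact Or.inr fun i => by rw [key]; exact hc i i.2

lemma coroot_simple_nonpos {b : Module.Basis {x // x ∈ P.Δ} ℚ V} (hb : ∀ i, b i = i)
    {i j : {x // x ∈ P.Δ}} (hij : i ≠ j) : P.coroot i (b j) ≤ 0 := by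
  have hi := P.base_subset i.2
  have hj := P.base_subset j.2
  by_contra! hpos
  have hm := P.reflect_mem i hi j hj
  rw [← hb j, ← hb i] at hm
  rw [← hb i] at hpos
  obtain h | h := repr_nonneg_or_nonpos hb hm
  · have : P.coroot (b i) (b j) ≤ 0 := by simpa [hij.symm] using h i
    linarith
  · have : (1 : ℚ) ≤ 0 := by simpa [hij] using h j
    linarith

end BasedRootSystem

/-- A vector pairing nonnegatively with an obtuse basis has nonnegative coordinates. -/
lemma Module.Basis.repr_nonneg_of_obtuse {V ι : Type*} [AddCommGroup V] [Module ℚ V] [Fintype ι]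
    (b : Module.Basis ι ℚ V) (C : V →ₗ[ℚ] Module.Dual ℚ V)
    (hdef : ∀ x, C x x ≤ 0 → x = 0) (hobt : ∀ i j, i ≠ j → C (b i) (b j) ≤ 0)
    {w : V} (hw : ∀ i, 0 ≤ C (b i) w) (i : ι) : 0 ≤ b.repr w i := by
  set q : V := ∑ i, max (-b.repr w i) 0 • b i with hq
  have hqw : 0 ≤ C q w := by
    simp only [hq, map_sum, map_smul, LinearMap.sum_apply, LinearMap.smul_apply, smul_eq_mul]
    exact Finset.sum_nonneg fun i _ => mul_nonneg (le_max_right _ _) (hw i)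
  have hp : q + w = ∑ i, max (b.repr w i) 0 • b i := by
    conv_lhs => enter [2]; rw [← b.sum_repr w]
    rw [hq, ← Finset.sum_add_distrib]
    refine Finset.sum_congr rfl fun i _ => ?_
    rw [← add_smul]
    congr 1
    grind
  have hqp : C q (q + w) ≤ 0 := by
    rw [hp]
    simp only [hq, map_sum, map_smul, LinearMap.sum_apply, LinearMap.smul_apply, smul_eq_mul]
    refine Finset.sum_nonpos fun j _ => ?_
    rw [Finset.mul_sum]
    refine Finset.sum_nonpos fun i _ => ?_
    by_cases hij : i = j
    · subst hij
      obtain h | h := le_total 0 (b.repr w i) <;> simp [h]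
    · exact mul_nonpos_of_nonneg_of_nonpos (le_max_right _ _)
        (mul_nonpos_of_nonneg_of_nonpos (le_max_right _ _) (hobt _ _ (by tauto)))
  have hq0 : q = 0 := hdef q (by rw [map_add] at hqp; linarith)
  have := congrArg (fun x => b.repr x i) hq0
  simp only [hq, b.repr_sum_self, map_zero, Finsupp.zero_apply] at this
  grind

namespace BasedRootSystem

variable {V : Type*} [AddCommGroup V] [Module ℚ V] {P : BasedRootSystem V}

/-- If the base splits into two orthogonal parts, then the support of a root lies in one part. -/
lemma repr_eq_zero_of_orthogonal {b : Module.Basis {x // x ∈ P.Δ} ℚ V} (hb : ∀ i, b i = i)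
    {C : V →ₗ[ℚ] Module.Dual ℚ V} (hdef : ∀ x, C x x ≤ 0 → x = 0)
    (hco : ∀ β ∈ P.Φ, ∃ n : ℚ, 0 < n ∧ P.coroot β = n • C β)
    {S : Set {x // x ∈ P.Δ}} (hS : ∀ i ∈ S, ∀ k ∉ S, C (b i) (b k) = 0)
    {β : V} (hβ : β ∈ P.Φ) {i k : {x // x ∈ P.Δ}} (hi : i ∈ S) (hk : k ∉ S)
    (hki : b.repr β k ≠ 0) : b.repr β i = 0 := by
  classical
  by_contra hii
  let mixed : Finset V := P.Φ.filter fun β => (∀ j, 0 ≤ b.repr β j) ∧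
    (∃ i ∈ S, b.repr β i ≠ 0) ∧ ∃ k ∉ S, b.repr β k ≠ 0
  have hne : mixed.Nonempty := by
    obtain h | h := repr_nonneg_or_nonpos hb hβ
    · exact ⟨β, by simp only [mixed, Finset.mem_filter]; exact ⟨hβ, h, ⟨i, hi, hii⟩, k, hk, hki⟩⟩
    · refine ⟨-β, ?_⟩
      simp only [mixed, Finset.mem_filter]
      exact ⟨P.neg_mem hβ, by simpa using h, ⟨i, hi, by simpa using hii⟩, k, hk, by simpa using hki⟩
  obtain ⟨γ, hγ, hmin⟩ := mixed.exists_min_image (fun β => ∑ j, b.repr β j) hne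
  simp only [mixed, Finset.mem_filter] at hγ hmin
  obtain ⟨hγΦ, hγ0, ⟨i, hi, hγi⟩, k, hk, hγk⟩ := hγ
  set x : V := ∑ j, (if j ∈ S then b.repr γ j else 0) • b j with hx
  have hCx {j} (hj : j ∈ S) : C (b j) γ = C (b j) x := by
    conv_lhs => rw [← b.sum_repr γ]
    simp only [hx, map_sum, map_smul, smul_eq_mul]
    refine Finset.sum_congr rfl fun l _ => ?_
    by_cases hl : l ∈ S
    · simp [hl]
    · simp [hl, hS j hj l hl]
  have hx0 : x ≠ 0 := fun h => hγi <| by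
    have := congrArg (fun y => b.repr y i) h
    simpa only [hx, b.repr_sum_self, hi, if_true, map_zero, Finsupp.zero_apply] using this
  obtain ⟨j, hj, hpos⟩ : ∃ j ∈ S, 0 < C (b j) x := by
    by_contra! hcon
    refine hx0 (hdef x ?_)
    conv_lhs => enter [1]; rw [hx]
    simp only [map_sum, map_smul, LinearMap.sum_apply, LinearMap.smul_apply, smul_eq_mul]
    refine Finset.sum_nonpos fun l _ => ?_
    split_ifs with hl
    · exact mul_nonpos_of_nonneg_of_nonpos (hγ0 l) (hcon l hl)
    · simp
  have hjΦ := P.base_subset j.2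
  obtain ⟨n, hn, hnC⟩ := hco j hjΦ
  rw [← hb j] at hnC hjΦ
  set t := P.coroot (b j) γ with ht
  have ht' : t = P.coroot (b j) x := by
    rw [ht, hnC, LinearMap.smul_apply, LinearMap.smul_apply, hCx hj]
  have htpos : 0 < t := by
    rw [ht', hnC, LinearMap.smul_apply]
    exact mul_pos hn hpos
  have hδ := P.reflect_mem _ hjΦ _ hγΦ
  rw [← ht] at hδ
  have hrepr (l) : b.repr (γ - t • b j) l = b.repr γ l - if l = j then t else 0 := by
    simp [Finsupp.single_apply, eq_comm]
  have hkj : k ≠ j := fun h => hk (h ▸ hj)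
  have hδk : b.repr (γ - t • b j) k = b.repr γ k := by simp [hkj]
  have hδ0 : ∀ l, 0 ≤ b.repr (γ - t • b j) l := by
    refine (repr_nonneg_or_nonpos hb hδ).resolve_right fun h => hγk (le_antisymm ?_ (hγ0 k))
    exact hδk ▸ h k
  have hδS : ∃ l ∈ S, b.repr (γ - t • b j) l ≠ 0 := by
    by_contra! hcon
    have hxt : x = t • b j := by
      refine b.repr.injective (Finsupp.ext fun l => ?_)
      rw [hx, b.repr_sum_self]
      by_cases hl : l ∈ S
      · have := hcon l hl
        rw [hrepr] at this
        simp only [hl, if_true, map_smul, b.repr_self, Finsupp.smul_apply, Finsupp.single_apply,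
          smul_eq_mul, eq_comm (a := j)]
        split_ifs at this ⊢ <;> linarith
      · have : j ≠ l := fun h => hl (h ▸ hj)
        simp [hl, this]
    rw [hxt, map_smul, P.coroot_self_eq_two _ hjΦ, smul_eq_mul] at ht'
    linarith
  have hlt := hmin _ ⟨hδ, hδ0, hδS, k, hk, by rwa [hδk]⟩
  simp only [hrepr, Finset.sum_sub_distrib, Finset.sum_ite_eq', Finset.mem_univ, if_true] at hlt
  linarith

/-- The base of an irreducible root system is connected. -/
lemma IsIrreducible.eq_empty_or_eq_univ (hirr : P.IsIrreducible)
    {b : Module.Basis {x // x ∈ P.Δ} ℚ V} (hb : ∀ i, b i = i)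
    {C : V →ₗ[ℚ] Module.Dual ℚ V} (hdef : ∀ x, C x x ≤ 0 → x = 0)
    (hco : ∀ β ∈ P.Φ, ∃ n : ℚ, 0 < n ∧ P.coroot β = n • C β)
    {S : Set {x // x ∈ P.Δ}} (hS : ∀ i ∈ S, ∀ k ∉ S, C (b i) (b k) = 0) :
    S = ∅ ∨ S = Set.univ := by
  have hmem (i) : b i ∈ P.Φ := hb i ▸ P.base_subset i.2
  have horth : ∀ α ∈ P.Φ, ∀ β ∈ P.Φ, α ∈ {β | ∀ k ∉ S, b.repr β k = 0} →
      β ∉ {β | ∀ k ∉ S, b.repr β k = 0} → P.coroot α β = 0 := by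
    intro α hα β hβ hαs hβs
    simp only [Set.mem_ofPred_eq, not_forall] at hαs hβs
    obtain ⟨k, hk, hβk⟩ := hβs
    obtain ⟨n, -, hn⟩ := hco α hα
    have hαβ : C α β = 0 := by
      rw [← b.sum_repr α, ← b.sum_repr β]
      simp only [map_sum, map_smul, LinearMap.sum_apply, LinearMap.smul_apply, smul_eq_mul]
      refine Finset.sum_eq_zero fun l _ => ?_
      rw [Finset.mul_sum]
      refine Finset.sum_eq_zero fun i _ => ?_
      by_cases hi : i ∈ S
      · by_cases hl : l ∈ S
        · simp [repr_eq_zero_of_orthogonal hb hdef hco hS hβ hl hk hβk]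
        · simp [hS i hi l hl]
      · simp [hαs i hi]
    simp [hn, hαβ]
  obtain h | h := hirr.2 _ horth
  · refine Or.inr (Set.eq_univ_of_forall fun i => ?_)
    by_contra hi
    simpa using h _ (hmem i) i hi
  · refine Or.inl (Set.eq_empty_of_forall_notMem fun i hi => h _ (hmem i) fun k hk => ?_)
    have : i ≠ k := fun h => hk (h ▸ hi)
    simp [this]

end BasedRootSystem

/-- if `Φ` is irreducible, `J ⊊ Δ`, and `v` is dominant and lies in the
`ℚ`-span of the coroots of `Φ_J`, then `v` is central: `⟨v, α⟩ = 0` for all `α ∈ Φ`. -/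
theorem central_of_dominant_mem_span_coroots_of_proper_J
    {V : Type*} [AddCommGroup V] [Module ℚ V] [FiniteDimensional ℚ V]
    (P : BasedRootSystem V)
    (hirr : P.IsIrreducible)
    (J : Finset V) (hJ : J ⊂ P.Δ)
    (v : Module.Dual ℚ V)
    (hdom : ∀ α ∈ P.pos, 0 ≤ v α)
    (hv : v ∈ Submodule.span ℚ (P.coroot '' (P.rootsIn J : Set V))) :
    ∀ α ∈ P.Φ, v α = 0 := by
  classical
  obtain ⟨C, hsymm, hdef, hco⟩ := P.exists_form
  obtain ⟨b, hb⟩ := P.exists_basis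
  obtain ⟨w, hwJ, rfl⟩ : v ∈ (Submodule.span ℚ (J : Set V)).map C := by
    refine Submodule.span_le.2 ?_ hv
    rintro - ⟨β, hβ, rfl⟩
    simp only [BasedRootSystem.rootsIn, Finset.coe_filter, Set.mem_ofPred_eq] at hβ
    obtain ⟨n, -, hn⟩ := hco β hβ.1
    rw [hn]
    exact Submodule.smul_mem _ _ (Submodule.mem_map_of_mem hβ.2)
  have hobt (i j) (hij : i ≠ j) : C (b i) (b j) ≤ 0 := by
    obtain ⟨n, hn, hnC⟩ := hco i (P.base_subset i.2)
    have h := BasedRootSystem.coroot_simple_nonpos hb hij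
    rw [hnC, LinearMap.smul_apply, smul_eq_mul, ← hb i] at h
    exact nonpos_of_mul_nonpos_right h hn
  have hw (i) : 0 ≤ C w (b i) := by
    refine hdom _ ?_
    simp only [BasedRootSystem.pos, Finset.mem_filter]
    refine ⟨hb i ▸ P.base_subset i.2, Pi.single (i : V) 1, fun α _ => ?_, ?_⟩
    · by_cases h : α = i <;> simp [h]
    · simp [Pi.single_apply, hb]
  have hc := b.repr_nonneg_of_obtuse C hdef hobt fun i => hsymm w (b i) ▸ hw i
  have hS : ∀ i ∈ {i | b.repr w i ≠ 0}, ∀ k ∉ {i | b.repr w i ≠ 0}, C (b i) (b k) = 0 := by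
    intro i hi k hk
    simp only [Set.mem_ofPred_eq, ne_eq, not_not] at hi hk
    have hterm : ∀ l ∈ Finset.univ, b.repr w l * C (b l) (b k) ≤ 0 := by
      intro l _
      by_cases hl : l = k
      · simp [hl, hk]
      · exact mul_nonpos_of_nonneg_of_nonpos (hc l) (hobt l k hl)
    have hwk : C w (b k) = ∑ l, b.repr w l * C (b l) (b k) := by
      conv_lhs => rw [← b.sum_repr w]
      simp
    have h0 := (Finset.sum_eq_zero_iff_of_nonpos hterm).1
      (le_antisymm (Finset.sum_nonpos hterm) (hwk ▸ hw k)) i (Finset.mem_univ i)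
    exact (mul_eq_zero.1 h0).resolve_left hi
  obtain ⟨i₀, hi₀, hi₀J⟩ := Finset.exists_of_ssubset hJ
  have hwi₀ : b.repr w ⟨i₀, hi₀⟩ = 0 := by
    have : Submodule.span ℚ (J : Set V) ≤ LinearMap.ker (b.coord ⟨i₀, hi₀⟩) := by
      refine Submodule.span_le.2 fun j hj => ?_
      have hne : (⟨j, hJ.1 hj⟩ : {x // x ∈ P.Δ}) ≠ ⟨i₀, hi₀⟩ := fun h =>
        hi₀J (Subtype.mk.inj h ▸ hj)
      have hbj : j = b ⟨j, hJ.1 hj⟩ := (hb ⟨j, hJ.1 hj⟩).symm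
      rw [SetLike.mem_coe, LinearMap.mem_ker, hbj]
      simp [hne]
    simpa using this hwJ
  have hw0 : w = 0 := by
    obtain h | h := hirr.eq_empty_or_eq_univ hb hdef hco hS
    · refine b.repr.injective (Finsupp.ext fun i => ?_)
      by_contra hi
      exact (Set.eq_empty_iff_forall_notMem.1 h) i (by simpa using hi)
    · exact absurd hwi₀ (Set.eq_univ_iff_forall.1 h ⟨i₀, hi₀⟩)
  simp [hw0]
end
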